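/- Let 𝒟 = {(X_i, B_i): i ∈ I} be a collection of random variable/nonempty event pairs with coherent₁ conditional previsions {P(X_i|B_i): i ∈ I}, and let (X, B) be a random variable/nonempty event pair such that the pairs (1_B, Ω) and (X·1_B, Ω) belong to 𝒟 with P(B) > 0. Then the unique extended-real value p such that adjoining the conditional prevision P(X|B) = p to the collection remains coherent₁ is p = P(X·1_B)/P(B), where this quotient is the infinite value with the same sign as P(X·1_B) when P(X·1_B) is infinite. -/

import Mathlib

open scoped BigOperators

noncomputable section

/-- The indicator function of an event `B`, as a real-valued random variable. -/
def indicatorRV {Ω : Type*} (B : Set Ω) : Ω → ℝ := B.indicator fun _ => 1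

/-- De Finetti-style coherence₁ for a collection of conditional previsions
`P (X i | B i)`, allowing infinite previsions.  For every finite subcollection,
all real coefficients `α j` (nonnegative where the prevision is `⊤`, nonpositive
where it is `⊥`), and all real prices `c j` that agree with the prevision wherever
it is finite, the resulting acceptable gamble has nonnegative supremum. -/
def Coherent1 {Ω I : Type*} (X : I → Ω → ℝ) (B : I → Set Ω) (P : I → EReal) : Prop :=
  ∀ (n : ℕ) (idx : Fin n → I) (α c : Fin n → ℝ),
    (∀ j, P (idx j) = ⊤ → 0 ≤ α j) →
    (∀ j, P (idx j) = ⊥ → α j ≤ 0) →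
    (∀ j, P (idx j) ≠ ⊤ → P (idx j) ≠ ⊥ → (c j : EReal) = P (idx j)) →
    0 ≤ ⨆ ω, ((∑ j, α j * indicatorRV (B (idx j)) ω * (X (idx j) ω - c j) : ℝ) : EReal)


/-- Adjoin one further random variable to a collection indexed by `I`
(the new one is indexed by `none`). -/
def adjoinX {Ω I : Type*} (X : I → Ω → ℝ) (Y : Ω → ℝ) : Option I → Ω → ℝ :=
  fun o => o.elim Y X

/-- Adjoin one further conditioning event to a collection indexed by `I`. -/
def adjoinB {Ω I : Type*} (B : I → Set Ω) (C : Set Ω) : Option I → Set Ω :=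
  fun o => o.elim C B

/-- Adjoin one further prevision to a collection indexed by `I`. -/
def adjoinP {I : Type*} (P : I → EReal) (p : EReal) : Option I → EReal :=
  fun o => o.elim p P

/-- Coherence₁ may be tested on families of bets indexed by any finite type. -/
theorem Coherent1.iSup_nonneg {Ω I κ : Type*} [Fintype κ] {X : I → Ω → ℝ} {B : I → Set Ω}
    {P : I → EReal} (h : Coherent1 X B P) (idx : κ → I) (α c : κ → ℝ)
    (htop : ∀ j, P (idx j) = ⊤ → 0 ≤ α j) (hbot : ∀ j, P (idx j) = ⊥ → α j ≤ 0)
    (hc : ∀ j, P (idx j) ≠ ⊤ → P (idx j) ≠ ⊥ → (c j : EReal) = P (idx j)) :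
    0 ≤ ⨆ ω, ((∑ j, α j * indicatorRV (B (idx j)) ω * (X (idx j) ω - c j) : ℝ) : EReal) := by
  let e := (Fintype.equivFin κ).symm
  convert h (Fintype.card κ) (idx ∘ e) (α ∘ e) (c ∘ e) (fun j => htop (e j))
    (fun j => hbot (e j)) (fun j => hc (e j)) using 4 with ω
  exact (e.sum_comp fun j => α j * indicatorRV (B (idx j)) ω * (X (idx j) ω - c j)).symm

theorem indicatorRV_univ {Ω : Type*} (ω : Ω) : indicatorRV Set.univ ω = 1 := by
  simp [indicatorRV]

theorem indicatorRV_le_one {Ω : Type*} (B : Set Ω) (ω : Ω) : indicatorRV B ω ≤ 1 :=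
  Set.indicator_apply_le' (fun _ => le_rfl) fun _ => zero_le_one

theorem indicatorRV_mul_self {Ω : Type*} (B : Set Ω) (ω : Ω) :
    indicatorRV B ω * indicatorRV B ω = indicatorRV B ω := by
  by_cases h : ω ∈ B <;> simp [indicatorRV, h]

/-- The marginal prevision of an event is never `⊤`. -/
theorem Coherent1.event_ne_top {Ω I : Type*} {X : I → Ω → ℝ} {B : I → Set Ω}
    {P : I → EReal} (h : Coherent1 X B P) {C : Set Ω} {i : I}
    (hX : X i = indicatorRV C) (hB : B i = Set.univ) : P i ≠ ⊤ := by
  intro hi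
  have key := h.iSup_nonneg (fun _ : Unit => i) (fun _ => 1) (fun _ => 2)
    (by simp) (by simp [hi]) (by simp [hi])
  have hle : ⨆ ω, ((∑ _ : Unit, 1 * indicatorRV (B i) ω * (X i ω - 2) : ℝ) : EReal)
      ≤ ((-1 : ℝ) : EReal) := by
    refine iSup_le fun ω => EReal.coe_le_coe_iff.2 ?_
    have := indicatorRV_le_one C ω
    simp only [hX, hB, indicatorRV_univ, Finset.univ_unique, Finset.sum_const,
      Finset.card_singleton, one_smul]
    linarith
  have := EReal.coe_le_coe_iff.1 (key.trans hle)
  norm_num at this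

/-- Combining a bet on `Z` given `C` with bets on `Z·1_C` and on `1_C` into a constant gamble
relates the three prices. -/
theorem Coherent1.stake_mul_sub_nonneg {Ω I : Type*} [Nonempty Ω] {X : I → Ω → ℝ}
    {B : I → Set Ω} {P : I → EReal} (h : Coherent1 X B P) {Z : Ω → ℝ} {C : Set Ω}
    {i iB iZB : I} (hX : X i = Z) (hB : B i = C)
    (hiB₁ : X iB = indicatorRV C) (hiB₂ : B iB = Set.univ)
    (hiZB₁ : X iZB = fun ω => Z ω * indicatorRV C ω) (hiZB₂ : B iZB = Set.univ)
    {b : ℝ} (hb : P iB = b) (s c q : ℝ)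
    (hi_top : P i = ⊤ → 0 ≤ s) (hi_bot : P i = ⊥ → s ≤ 0)
    (hi : P i ≠ ⊤ → P i ≠ ⊥ → (c : EReal) = P i)
    (hiZB_top : P iZB = ⊤ → s ≤ 0) (hiZB_bot : P iZB = ⊥ → 0 ≤ s)
    (hiZB : P iZB ≠ ⊤ → P iZB ≠ ⊥ → (q : EReal) = P iZB) :
    0 ≤ s * (q - c * b) := by
  have key := h.iSup_nonneg ![i, iZB, iB] ![s, -s, s * c] ![c, q, b]
    (by simpa [Fin.forall_fin_succ, hb] using ⟨hi_top, hiZB_top⟩)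
    (by simpa [Fin.forall_fin_succ, hb] using ⟨hi_bot, hiZB_bot⟩)
    (by simpa [Fin.forall_fin_succ, hb] using ⟨hi, hiZB⟩)
  have hconst : ∀ ω, ∑ j, ![s, -s, s * c] j * indicatorRV (B (![i, iZB, iB] j)) ω *
      (X (![i, iZB, iB] j) ω - ![c, q, b] j) = s * (q - c * b) := by
    intro ω
    simp only [Fin.sum_univ_three, Matrix.cons_val, hX, hB, hiB₁, hiB₂, hiZB₁, hiZB₂,
      indicatorRV_univ]
    ring
  simp only [hconst, iSup_const] at key
  exact_mod_cast key

/-- A bet on `Z` given `C` at price `c` is a bet on `Z·1_C` at price `c * b` together with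
a bet on `1_C` at price `b`, so adjoining the quotient prevision preserves coherence₁. -/
theorem Coherent1.adjoin_div {Ω I : Type*} {X : I → Ω → ℝ}
    {B : I → Set Ω} {P : I → EReal} (h : Coherent1 X B P) {Z : Ω → ℝ} {C : Set Ω}
    {iB iZB : I} (hiB₁ : X iB = indicatorRV C) (hiB₂ : B iB = Set.univ)
    (hiZB₁ : X iZB = fun ω => Z ω * indicatorRV C ω) (hiZB₂ : B iZB = Set.univ)
    {b : ℝ} (hb : P iB = b) (hb_pos : 0 < b) :
    Coherent1 (adjoinX X Z) (adjoinB B C) (adjoinP P (P iZB / b)) := by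
  have hb_pos' : (0 : EReal) < b := EReal.coe_pos.2 hb_pos
  intro n idx α c htop hbot hc
  convert h.iSup_nonneg
    (Sum.elim (fun j : Fin n => (idx j).getD iZB) (fun _ : Fin n => iB))
    (Sum.elim α (fun j => (idx j).elim (-(α j * c j)) (fun _ => 0)))
    (Sum.elim (fun j => (idx j).elim (c j * b) (fun _ => c j)) (fun _ => b))
    ?_ ?_ ?_ using 4 with ω
  · rw [Fintype.sum_sum_type, ← Finset.sum_add_distrib]
    refine Finset.sum_congr rfl fun j _ => ?_
    rcases hj : idx j with _ | i
    · simp only [adjoinX, adjoinB, Sum.elim_inl, Sum.elim_inr, hj, Option.elim, Option.getD,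
        hiB₁, hiB₂, hiZB₁, hiZB₂, indicatorRV_univ]
      ring
    · simp [adjoinX, adjoinB, hj]
  · rintro (j | j) hj
    · apply htop j
      rcases hij : idx j with _ | i <;> simp only [Sum.elim_inl, hij, Option.getD] at hj
      · simpa [adjoinP, hj] using EReal.top_div_of_pos_ne_top hb_pos' (EReal.coe_ne_top b)
      · simpa [adjoinP] using hj
    · simp [hb] at hj
  · rintro (j | j) hj
    · apply hbot j
      rcases hij : idx j with _ | i <;> simp only [Sum.elim_inl, hij, Option.getD] at hj
      · simpa [adjoinP, hj] using EReal.bot_div_of_pos_ne_top hb_pos' (EReal.coe_ne_top b)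
      · simpa [adjoinP] using hj
    · simp [hb] at hj
  · rintro (j | j) hj_top hj_bot
    · have hcj := hc j
      rcases hij : idx j with _ | i <;>
        simp only [Sum.elim_inl, hij, Option.getD, Option.elim, adjoinP] at hj_top hj_bot hcj ⊢
      · lift P iZB to ℝ using ⟨hj_top, hj_bot⟩ with q
        rw [← EReal.coe_div] at hcj
        have hcq := EReal.coe_injective (hcj (EReal.coe_ne_top _) (EReal.coe_ne_bot _))
        rw [hcq, div_mul_cancel₀ _ hb_pos.ne']
      · exact hcj hj_top hj_bot
    · simp [hb]

/-- If a coherent₁ collection of conditional previsions contains the marginal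
previsions `P(1_C)` and `P(Z·1_C)` with `P(1_C) > 0`, then the unique extended-real
value `p` such that adjoining the conditional prevision `P(Z|C) = p` keeps the
collection coherent₁ is `p = P(Z·1_C) / P(1_C)` (which is the infinite value with the
same sign as `P(Z·1_C)` when the latter is infinite). -/
theorem conditional_prevision_of_pos {Ω I : Type*} [Nonempty Ω]
    (X : I → Ω → ℝ) (B : I → Set Ω) (hBne : ∀ i, (B i).Nonempty) (P : I → EReal)
    (hcoh : Coherent1 X B P)
    (Z : Ω → ℝ) (C : Set Ω) (hC : C.Nonempty)
    (iB iZB : I)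
    (hiB₁ : X iB = indicatorRV C) (hiB₂ : B iB = Set.univ)
    (hiZB₁ : X iZB = fun ω => Z ω * indicatorRV C ω) (hiZB₂ : B iZB = Set.univ)
    (hpos : 0 < P iB) :
    ∀ p : EReal,
      Coherent1 (adjoinX X Z) (adjoinB B C) (adjoinP P p) ↔ p = P iZB / P iB := by
  have hb_top := hcoh.event_ne_top hiB₁ hiB₂
  obtain ⟨b, hb⟩ : ∃ b : ℝ, P iB = b :=
    ⟨_, (EReal.coe_toReal hb_top (bot_le.trans_lt hpos).ne').symm⟩
  have hb_pos' : (0 : EReal) < b := hb ▸ hpos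
  have hb_pos : 0 < b := EReal.coe_pos.1 hb_pos'
  intro p
  rw [hb]
  refine ⟨fun h => ?_, fun h => h ▸ hcoh.adjoin_div hiB₁ hiB₂ hiZB₁ hiZB₂ hb hb_pos⟩
  have key := h.stake_mul_sub_nonneg (i := none) (iB := some iB) (iZB := some iZB)
    rfl rfl hiB₁ hiB₂ hiZB₁ hiZB₂ hb
  simp only [adjoinP, Option.elim] at key
  have hcancel (x : ℝ) : x / b * b = x := div_mul_cancel₀ x hb_pos.ne'
  generalize P iZB = Q at key ⊢
  induction p with
  | top =>
    induction Q with
    | top => rw [EReal.top_div_of_pos_ne_top hb_pos' (EReal.coe_ne_top b)]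
    | coe q =>
      have := key 1 ((q + 1) / b) q (by simp) (by simp) (by simp) (by simp) (by simp) (by simp)
      linarith [hcancel (q + 1)]
    | bot =>
      have := key 1 (1 / b) 0 (by simp) (by simp) (by simp) (by simp) (by simp) (by simp)
      linarith [hcancel 1]
  | coe p =>
    induction Q with
    | top =>
      have := key (-1) p (p * b + 1) (by simp) (by simp) (by simp) (by simp) (by simp) (by simp)
      linarith
    | coe q =>
      have h₁ := key 1 p q (by simp) (by simp) (by simp) (by simp) (by simp) (by simp)
      have h₂ := key (-1) p q (by simp) (by simp) (by simp) (by simp) (by simp) (by simp)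
      rw [← EReal.coe_div, EReal.coe_eq_coe_iff, eq_div_iff hb_pos.ne']
      linarith
    | bot =>
      have := key 1 p (p * b - 1) (by simp) (by simp) (by simp) (by simp) (by simp) (by simp)
      linarith
  | bot =>
    induction Q with
    | top =>
      have := key (-1) (-1 / b) 0 (by simp) (by simp) (by simp) (by simp) (by simp) (by simp)
      linarith [hcancel (-1)]
    | coe q =>
      have := key (-1) ((q - 1) / b) q (by simp) (by simp) (by simp) (by simp) (by simp)
        (by simp)
      linarith [hcancel (q - 1)]
    | bot => rw [EReal.bot_div_of_pos_ne_top hb_pos' (EReal.coe_ne_top b)]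

end
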